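/- The transformation Φ : Ω → Ω, Φ(ξ₋,ξ₊) = (1/ξ₋ − [1/ξ₊], Ψ(ξ₊)), preserves the probability measure m̂ defined by dm̂(ξ₋,ξ₊) = q² dμ(ξ₋) dμ(ξ₊)/|ξ₊ − ξ₋|²_∞, i.e. Φ_* m̂ = m̂. -/

import Mathlib

open MeasureTheory
open scoped ENNReal Classical

noncomputable section

namespace ArtinCoding

variable (k : Type*) [Field k] [Fintype k]

/-- The field `K̂ = k((X⁻¹))` of formal Laurent series in `X⁻¹` over `k`, realized as the
field of formal Laurent series `k((t))` in the variable `t = X⁻¹`. -/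
abbrev Khat := LaurentSeries k

variable {k}

/-- The absolute value `|f|_∞ = q^{-v_∞(f)}`, where `v_∞` is the order of vanishing in the
variable `t = X⁻¹` (so a nonzero polynomial in `X` has absolute value `≥ 1`). -/
def absInf (f : Khat k) : ℝ :=
  if f = 0 then 0 else (Fintype.card k : ℝ) ^ (-f.order)

lemma absInf_nonneg (f : Khat k) : 0 ≤ absInf f := by
  unfold absInf
  split
  · exact le_refl 0
  · positivity

lemma absInf_eq_zero {f : Khat k} : absInf f = 0 ↔ f = 0 := by
  constructor
  · intro h
    by_contra hf
    have hq : (0:ℝ) < (Fintype.card k : ℝ) := by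
      have := Fintype.card_pos (α := k); positivity
    rw [absInf, if_neg hf] at h
    exact absurd h (ne_of_gt (zpow_pos hq _))
  · intro h; simp [absInf, h]

lemma absInf_neg (f : Khat k) : absInf (-f) = absInf f := by
  unfold absInf
  rw [neg_eq_zero, HahnSeries.order_neg]

lemma absInf_add_le (f g : Khat k) : absInf (f + g) ≤ max (absInf f) (absInf g) := by
  rcases eq_or_ne (f + g) 0 with h | h
  · rw [show absInf (f+g) = 0 by rw [absInf_eq_zero]; exact h]
    exact le_max_of_le_left (absInf_nonneg f)
  rcases eq_or_ne f 0 with hf | hf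
  · simp [hf]
  rcases eq_or_ne g 0 with hg | hg
  · simp [hg]
  have hmin := HahnSeries.min_order_le_order_add h
  have hq : (1:ℝ) ≤ (Fintype.card k : ℝ) := by
    exact_mod_cast Nat.one_le_iff_ne_zero.mpr Fintype.card_ne_zero
  rw [absInf, if_neg h]
  rcases le_total f.order g.order with hod | hod
  · rw [min_eq_left hod] at hmin
    refine le_max_of_le_left ?_
    rw [absInf, if_neg hf]
    exact zpow_le_zpow_right₀ hq (neg_le_neg hmin)
  · rw [min_eq_right hod] at hmin
    refine le_max_of_le_right ?_
    rw [absInf, if_neg hg]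
    exact zpow_le_zpow_right₀ hq (neg_le_neg hmin)

/-- The metric `d_∞(f,g) = |f-g|_∞` on `K̂`. -/
noncomputable instance : MetricSpace (Khat k) where
  dist f g := absInf (f - g)
  dist_self f := by simp [absInf]
  dist_comm f g := by
    have : g - f = -(f - g) := by ring
    show absInf (f - g) = absInf (g - f)
    rw [this, absInf_neg]
  dist_triangle f g h := by
    show absInf (f - h) ≤ absInf (f - g) + absInf (g - h)
    have key : absInf (f - h) ≤ max (absInf (f - g)) (absInf (g - h)) := by
      have : f - h = (f - g) + (g - h) := by ring
      rw [this]; exact absInf_add_le _ _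
    exact key.trans (max_le_add_of_nonneg (absInf_nonneg _) (absInf_nonneg _))
  eq_of_dist_eq_zero := by
    intro f g h
    have : f - g = 0 := absInf_eq_zero.mp h
    exact sub_eq_zero.mp this

/- Make sure the topology coming from the metric `d_∞` is the one used everywhere
(the valued-field uniformity on Laurent series induces the same topology). -/
instance (priority := 10000) : UniformSpace (Khat k) := PseudoMetricSpace.toUniformSpace
instance (priority := 10000) : TopologicalSpace (Khat k) := UniformSpace.toTopologicalSpace

instance : MeasurableSpace (Khat k) := borel _
instance : BorelSpace (Khat k) := ⟨rfl⟩

variable (k)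

/-- The element `X⁻¹` of `K̂` (the uniformizer `t`). -/
def Xinv : Khat k := HahnSeries.single (1 : ℤ) (1 : k)

/-- The element `X` of `K̂`. -/
def Xel : Khat k := HahnSeries.single (-1 : ℤ) (1 : k)

/-- The valuation ring `O = k[[X⁻¹]] = {f : |f|_∞ ≤ 1}`. -/
def Oball : Set (Khat k) := {f | absInf f ≤ 1}

/-- The set `X⁻¹O`, i.e. the maximal ideal of `O`. -/
def XinvO : Set (Khat k) := (fun f => Xinv k * f) '' Oball k

/-- The ring `A = k[X]` of polynomials in `X`, viewed as a subset of `K̂`. -/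
def Aset : Set (Khat k) := Set.range fun p : Polynomial k => Polynomial.aeval (Xel k) p

/-- The constants `k ⊆ K̂`. -/
def kconsts : Set (Khat k) := Set.range (algebraMap k (Khat k))

/-- The set `A∖k` of nonconstant polynomials in `X`, viewed inside `K̂`. -/
def AmK : Set (Khat k) := Aset k \ kconsts k

/-- The field `K = k(X)` of rational functions, viewed as a subset of `K̂`
(note that `k(X) = k(X⁻¹)` as a subfield of `K̂`). -/
def Kset : Set (Khat k) := Set.range fun r : RatFunc k => (r : LaurentSeries k)

/-- The set `ᶜK = K̂ ∖ K` of irrational elements. -/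
def cK : Set (Khat k) := (Kset k)ᶜ

variable {k}

/-- The integer part `[f] ∈ A = k[X]` of `f ∈ K̂`: the sum of the terms of `f` with
nonpositive exponents in `t = X⁻¹`. -/
def intPart (f : Khat k) : Khat k :=
  ∑ i ∈ Finset.Icc (min f.order 0) 0, HahnSeries.single i (f.coeff i)

/-- The fractional part `{f} = f - [f] ∈ X⁻¹O` of `f ∈ K̂`. -/
def fracPart (f : Khat k) : Khat k := f - intPart f

/-- The Artin map `Ψ(f) = 1/f - [1/f]`. -/
def ArtinPsi (f : Khat k) : Khat k := fracPart f⁻¹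

/-- The Artin continued fraction digit `a_{n+1}(f) = [1/Ψⁿ(f)]` (for `n : ℕ`, so that
`digit 0 f = a₁(f) = [1/f]`). -/
def digit (n : ℕ) (f : Khat k) : Khat k := intPart ((ArtinPsi (k := k))^[n] f)⁻¹

variable (k)

/-- The set `J = ⋃_{a ∈ A∖k} (a + X⁻¹O)`. -/
def Jset : Set (Khat k) := ⋃ a ∈ AmK k, (fun x => a + x) '' XinvO k

/-- The domain `Ω = (J ∩ ᶜK) × (X⁻¹O ∩ ᶜK)` of the natural extension of the Artin map. -/
def OmegaSet : Set (Khat k × Khat k) := (Jset k ∩ cK k) ×ˢ (XinvO k ∩ cK k)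

variable {k}

/-- The map `Φ(ξ₋, ξ₊) = (1/ξ₋ - [1/ξ₊], Ψ(ξ₊))` (as a globally defined map on `K̂ × K̂`). -/
def PhiRaw (p : Khat k × Khat k) : Khat k × Khat k :=
  (p.1⁻¹ - intPart p.2⁻¹, ArtinPsi p.2)

/-- The coding map `Θ'` sending `(ξ₋, ξ₊)` to the bilateral sequence `(c_n)_{n ∈ ℤ}` with
`c_n = a_n(ξ₊)` for `n ≥ 1` and `c_{-n} = a_{n+1}(-1/ξ₋)` for `n ≥ 0`. -/
def ThetaRaw (p : Khat k × Khat k) : ℤ → Khat k := fun n =>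
  if 1 ≤ n then digit (n - 1).toNat p.2 else digit (-n).toNat (-p.1⁻¹)

variable (k)

/-- The density `q²/|ξ₊ - ξ₋|²_∞`. -/
def dens (p : Khat k × Khat k) : ℝ≥0∞ :=
  ENNReal.ofReal ((Fintype.card k : ℝ) ^ 2 * ((absInf (p.2 - p.1)) ^ 2)⁻¹)

/-- The measure `m̂` on `Ω` given by `dm̂(ξ₋,ξ₊) = q² dμ(ξ₋) dμ(ξ₊)/|ξ₊ - ξ₋|²_∞`. -/
def mhat (μ : Measure (Khat k)) : Measure (Khat k × Khat k) :=
  (((μ.prod μ).withDensity (dens k))).restrict (OmegaSet k)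

/-- The weight `ν(a) = |a|_∞⁻² = q^{-2 deg a}` for `a ∈ A∖k` (and `0` otherwise),
with values in `ℝ≥0∞`. -/
def nuE (a : Khat k) : ℝ≥0∞ :=
  if a ∈ AmK k then ENNReal.ofReal (((absInf a) ^ 2)⁻¹) else 0

section

variable {k : Type*} [Field k]

lemma coeff_intPart (f : Khat k) (i : ℤ) :
    (intPart f).coeff i = if i ≤ 0 then f.coeff i else 0 := by
  have h (j : ℤ) : (HahnSeries.single j (f.coeff j)).coeff i =
      if i = j then f.coeff j else 0 := by
    rcases eq_or_ne i j with rfl | hij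
    · simp
    · simp [hij, HahnSeries.coeff_single_of_ne hij]
  rw [intPart, HahnSeries.coeff_sum]
  simp only [h, Finset.sum_ite_eq, Finset.mem_Icc]
  by_cases hi : i ≤ 0
  · by_cases h : i < f.order
    · simp [hi, HahnSeries.coeff_eq_zero_of_lt_order h]
    · simp [hi, not_lt.mp h]
  · simp [hi]

lemma intPart_add (f g : Khat k) : intPart (f + g) = intPart f + intPart g := by
  ext i
  simp only [coeff_intPart, HahnSeries.coeff_add]
  split_ifs <;> simp

lemma intPart_neg (f : Khat k) : intPart (-f) = -intPart f := by
  ext i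
  simp only [coeff_intPart, HahnSeries.coeff_neg]
  split_ifs <;> simp

lemma intPart_intPart (f : Khat k) : intPart (intPart f) = intPart f := by
  ext i
  simp only [coeff_intPart]
  split_ifs <;> rfl

lemma algebraMap_khat (c : k) : algebraMap k (Khat k) c = HahnSeries.single 0 c := by
  rw [HahnSeries.algebraMap_apply', PowerSeries.algebraMap_apply, HahnSeries.ofPowerSeries_C]
  rfl

lemma coeff_algebraMap_khat (c : k) (i : ℤ) :
    (algebraMap k (Khat k) c).coeff i = if i = 0 then c else 0 := by
  rw [algebraMap_khat, HahnSeries.coeff_single]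
  simp

lemma Xel_pow (n : ℕ) : Xel k ^ n = HahnSeries.single (-(n : ℤ)) (1 : k) := by
  simp [Xel, HahnSeries.single_pow]

lemma aeval_monomial_Xel (n : ℕ) (c : k) :
    Polynomial.aeval (Xel k) (Polynomial.monomial n c) = HahnSeries.single (-(n : ℤ)) c := by
  rw [Polynomial.aeval_monomial, Xel_pow, algebraMap_khat,
    HahnSeries.single_mul_single]
  simp

lemma intPart_mem_Aset (f : Khat k) : intPart f ∈ Aset k := by
  refine ⟨∑ i ∈ Finset.Icc (min f.order 0) 0, Polynomial.monomial (-i).toNat (f.coeff i), ?_⟩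
  simp only [map_sum, aeval_monomial_Xel]
  refine Finset.sum_congr rfl fun i hi => ?_
  rw [Finset.mem_Icc] at hi
  congr 2
  lia

lemma intPart_eq_self_of_mem_Aset {a : Khat k} (ha : a ∈ Aset k) : intPart a = a := by
  obtain ⟨p, rfl⟩ := ha
  induction p using Polynomial.induction_on' with
  | add p q hp hq => simp only [map_add, intPart_add] at hp hq ⊢; rw [hp, hq]
  | monomial n c =>
    simp only [aeval_monomial_Xel]
    ext i
    rw [coeff_intPart, HahnSeries.coeff_single]
    split_ifs <;> first | rfl | lia

/-- The composite of the shears `(u, v) ↦ (u - [v], v)` and `(u, v) ↦ (u, v + [u])`. -/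
def doubleShear (p : Khat k × Khat k) : Khat k × Khat k :=
  (p.1 - intPart p.2, p.2 + intPart (p.1 - intPart p.2))

lemma intPart_doubleShear_snd (p : Khat k × Khat k) :
    intPart (doubleShear p).2 = intPart p.1 := by
  simp [doubleShear, sub_eq_add_neg, intPart_add, intPart_neg, intPart_intPart]

end

section

variable {k : Type*} [Field k] [Fintype k]

lemma one_lt_card_real (k : Type*) [Field k] [Fintype k] : (1 : ℝ) < Fintype.card k := by
  exact_mod_cast Fintype.one_lt_card

lemma card_zpow_pos (k : Type*) [Field k] [Fintype k] (n : ℤ) :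
    (0 : ℝ) < (Fintype.card k : ℝ) ^ n :=
  zpow_pos (zero_lt_one.trans (one_lt_card_real k)) n

lemma absInf_le_zpow_iff (f : Khat k) (n : ℤ) :
    absInf f ≤ (Fintype.card k : ℝ) ^ (-n) ↔ ∀ i < n, f.coeff i = 0 := by
  rcases eq_or_ne f 0 with rfl | hf
  · simp [absInf, (card_zpow_pos k _).le]
  · rw [absInf, if_neg hf, zpow_le_zpow_iff_right₀ (one_lt_card_real k), neg_le_neg_iff,
      HahnSeries.le_order_iff_forall hf]

lemma absInf_mul (f g : Khat k) : absInf (f * g) = absInf f * absInf g := by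
  rcases eq_or_ne f 0 with rfl | hf
  · simp [absInf]
  rcases eq_or_ne g 0 with rfl | hg
  · simp [absInf]
  rw [absInf, absInf, absInf, if_neg hf, if_neg hg, if_neg (mul_ne_zero hf hg),
    HahnSeries.order_mul hf hg, neg_add,
    zpow_add₀ (zero_lt_one.trans (one_lt_card_real k)).ne']

lemma absInf_one : absInf (1 : Khat k) = 1 := by
  simp [absInf]

lemma absInf_inv (f : Khat k) : absInf f⁻¹ = (absInf f)⁻¹ := by
  rcases eq_or_ne f 0 with rfl | hf
  · simp [absInf]
  · refine eq_inv_of_mul_eq_one_left ?_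
    rw [← absInf_mul, inv_mul_cancel₀ hf, absInf_one]

lemma absInf_pos {f : Khat k} (hf : f ≠ 0) : 0 < absInf f :=
  (absInf_nonneg f).lt_of_ne fun h => hf (absInf_eq_zero.mp h.symm)

lemma absInf_sub_comm (f g : Khat k) : absInf (f - g) = absInf (g - f) := by
  rw [← neg_sub, absInf_neg]

lemma absInf_add_eq_left {f g : Khat k} (h : absInf g < absInf f) :
    absInf (f + g) = absInf f := by
  refine le_antisymm ((absInf_add_le f g).trans (max_le le_rfl h.le)) ?_
  have := absInf_add_le (f + g) (-g)
  rw [add_neg_cancel_right, absInf_neg, le_max_iff] at this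
  exact this.resolve_right h.not_ge

lemma exists_absInf_eq_zpow {f : Khat k} (hf : f ≠ 0) :
    ∃ n : ℤ, absInf f = (Fintype.card k : ℝ) ^ (-n) :=
  ⟨f.order, by rw [absInf, if_neg hf]⟩

lemma absInf_lt_one_iff (f : Khat k) : absInf f < 1 ↔ ∀ i ≤ 0, f.coeff i = 0 := by
  have h : absInf f < 1 ↔ absInf f ≤ (Fintype.card k : ℝ) ^ (-(1 : ℤ)) := by
    rcases eq_or_ne f 0 with rfl | hf
    · simp [absInf]
    · obtain ⟨n, hn⟩ := exists_absInf_eq_zpow hf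
      rw [hn, zpow_le_zpow_iff_right₀ (one_lt_card_real k),
        zpow_lt_one_iff_right₀ (one_lt_card_real k)]
      lia
  rw [h, absInf_le_zpow_iff]
  simp [Int.lt_iff_add_one_le]

lemma dist_eq_absInf (f g : Khat k) : dist f g = absInf (f - g) := rfl

instance : IsUltrametricDist (Khat k) where
  dist_triangle_max f g h := by
    have := absInf_add_le (f - g) (g - h)
    rwa [sub_add_sub_cancel] at this

instance : IsTopologicalAddGroup (Khat k) where
  continuous_add := by
    rw [Metric.continuous_iff]
    rintro ⟨a, b⟩ ε hε
    refine ⟨ε, hε, ?_⟩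
    rintro ⟨c, d⟩ h
    rw [Prod.dist_eq, max_lt_iff] at h
    simp only [dist_eq_absInf] at h ⊢
    rw [add_sub_add_comm]
    exact (absInf_add_le _ _).trans_lt (max_lt h.1 h.2)
  continuous_neg := by
    rw [Metric.continuous_iff]
    intro a ε hε
    refine ⟨ε, hε, fun b h => ?_⟩
    rw [dist_eq_absInf] at h ⊢
    rwa [neg_sub_neg, absInf_sub_comm]

/-- The coset `x + X⁻ⁿO`. -/
def coset (x : Khat k) (n : ℤ) : Set (Khat k) := {y | absInf (y - x) ≤ (Fintype.card k : ℝ) ^ (-n)}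

lemma coset_eq_closedBall (x : Khat k) (n : ℤ) :
    coset x n = Metric.closedBall x ((Fintype.card k : ℝ) ^ (-n)) := rfl

lemma mem_coset_self (x : Khat k) (n : ℤ) : x ∈ coset x n := by
  simp [coset, absInf, (card_zpow_pos k _).le]

lemma isOpen_coset (x : Khat k) (n : ℤ) : IsOpen (coset x n) :=
  IsUltrametricDist.isOpen_closedBall x (card_zpow_pos k _).ne'

lemma measurableSet_coset (x : Khat k) (n : ℤ) : MeasurableSet (coset x n) :=
  (isOpen_coset x n).measurableSet

lemma exists_zpow_lt (k : Type*) [Field k] [Fintype k] {ε : ℝ} (hε : 0 < ε) :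
    ∃ n : ℤ, (Fintype.card k : ℝ) ^ (-n) < ε := by
  obtain ⟨n, hn⟩ := exists_pow_lt_of_lt_one hε (inv_lt_one_of_one_lt₀ (one_lt_card_real k))
  exact ⟨n, by simpa using hn⟩

instance : SecondCountableTopology (Khat k) := by
  have : TopologicalSpace.SeparableSpace (Khat k) := by
    refine ⟨⟨Set.range (HahnSeries.ofFinsupp : (ℤ →₀ k) → Khat k), Set.countable_range _, ?_⟩⟩
    refine Metric.dense_iff.mpr fun f ε hε => ?_
    obtain ⟨n, hn⟩ := exists_zpow_lt k hε
    let g : ℤ →₀ k := Finsupp.onFinset (Finset.Ico f.order n)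
      (fun i => if i < n then f.coeff i else 0) (by
        intro i hi
        rw [Finset.mem_Ico]
        refine ⟨?_, ?_⟩
        · by_contra! h
          simp [HahnSeries.coeff_eq_zero_of_lt_order h] at hi
        · by_contra! h
          simp [h.not_gt] at hi)
    refine ⟨HahnSeries.ofFinsupp g, ?_, g, rfl⟩
    rw [Metric.mem_ball, dist_eq_absInf]
    refine lt_of_le_of_lt ?_ hn
    rw [absInf_le_zpow_iff]
    intro i hi
    simp [g, hi]
  exact UniformSpace.secondCountable_of_separable _

lemma isTopologicalBasis_coset :
    TopologicalSpace.IsTopologicalBasis {s : Set (Khat k) | ∃ x n, s = coset x n} := by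
  refine TopologicalSpace.isTopologicalBasis_of_isOpen_of_nhds ?_ ?_
  · rintro _ ⟨x, n, rfl⟩
    exact isOpen_coset x n
  · intro a u ha hu
    obtain ⟨ε, hε, h⟩ := Metric.isOpen_iff.mp hu a ha
    obtain ⟨n, hn⟩ := exists_zpow_lt k hε
    exact ⟨_, ⟨a, n, rfl⟩, mem_coset_self a n, (Metric.closedBall_subset_ball hn).trans h⟩

lemma measurableSpace_eq_generateFrom_coset :
    (inferInstance : MeasurableSpace (Khat k)) =
      MeasurableSpace.generateFrom {s : Set (Khat k) | ∃ x n, s = coset x n} :=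
  isTopologicalBasis_coset.borel_eq_generateFrom

lemma coset_trichotomy (x y : Khat k) (m n : ℤ) :
    coset x m ⊆ coset y n ∨ coset y n ⊆ coset x m ∨ Disjoint (coset x m) (coset y n) := by
  simpa only [coset_eq_closedBall] using IsUltrametricDist.closedBall_subset_trichotomy ..

lemma isPiSystem_coset : IsPiSystem {s : Set (Khat k) | ∃ x n, s = coset x n} := by
  rintro _ ⟨x, m, rfl⟩ _ ⟨y, n, rfl⟩ hne
  rcases coset_trichotomy x y m n with h | h | h
  · exact ⟨x, m, Set.inter_eq_left.mpr h⟩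
  · exact ⟨y, n, Set.inter_eq_right.mpr h⟩
  · exact absurd hne (Set.not_nonempty_iff_eq_empty.mpr h.inter_eq)

lemma zero_notMem_coset_iff (x : Khat k) (n : ℤ) :
    (0 : Khat k) ∉ coset x n ↔ (Fintype.card k : ℝ) ^ (-n) < absInf x := by
  simp [coset, absInf_neg]

lemma exists_zero_notMem_coset {x : Khat k} (hx : x ≠ 0) : ∃ n, (0 : Khat k) ∉ coset x n := by
  obtain ⟨n, hn⟩ := exists_zpow_lt k (absInf_pos hx)
  exact ⟨n, (zero_notMem_coset_iff x n).mpr hn⟩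

/-- Measures on `K̂` are determined by `{0}` and the cosets avoiding `0`. -/
lemma ext_of_coset {μ ν : Measure (Khat k)} (h0 : μ {0} = ν {0})
    (hfin : ∀ x n, (0 : Khat k) ∉ coset x n → μ (coset x n) ≠ ∞)
    (h : ∀ x n, (0 : Khat k) ∉ coset x n → μ (coset x n) = ν (coset x n)) : μ = ν := by
  choose! N hN using fun (x : Khat k) => exists_zero_notMem_coset (x := x)
  obtain ⟨S, hS0, hS, hcov⟩ := TopologicalSpace.countable_cover_nhdsWithin
    (f := fun x : Khat k => coset x (N x)) (s := {0}ᶜ)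
    fun x _ => mem_nhdsWithin_of_mem_nhds ((isOpen_coset x (N x)).mem_nhds (mem_coset_self x _))
  refine (Measure.ext_iff_of_biUnion_eq_univ (S := insert 0 S)
    (s := fun x => if x = 0 then {0} else coset x (N x)) (hS.insert 0) ?_).mpr ?_
  · refine Set.eq_univ_of_forall fun x => Set.mem_iUnion₂.mpr ?_
    by_cases hx : x = 0
    · exact ⟨0, Set.mem_insert _ _, by simp [hx]⟩
    · obtain ⟨y, hy, hxy⟩ := Set.mem_iUnion₂.mp (hcov (Set.mem_compl_singleton_iff.mpr hx))
      exact ⟨y, Set.mem_insert_of_mem _ hy, by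
        rwa [if_neg (Set.mem_compl_singleton_iff.mp (hS0 hy))]⟩
  · rintro x -
    by_cases hx : x = 0
    · simp [hx, h0, Measure.restrict_singleton]
    simp only [if_neg hx]
    have hxN := hN x hx
    have : IsFiniteMeasure (μ.restrict (coset x (N x))) :=
      ⟨by simpa using (hfin x _ hxN).lt_top⟩
    refine ext_of_generate_finite _ measurableSpace_eq_generateFrom_coset isPiSystem_coset ?_
      (by simpa using h x _ hxN)
    rintro _ ⟨y, n, rfl⟩
    rw [Measure.restrict_apply (measurableSet_coset y n),
      Measure.restrict_apply (measurableSet_coset y n)]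
    rcases coset_trichotomy y x n (N x) with hc | hc | hc
    · rw [Set.inter_eq_left.mpr hc]
      exact h y n fun hmem => hxN (hc hmem)
    · rw [Set.inter_eq_right.mpr hc]
      exact h x _ hxN
    · simp [hc.inter_eq]

lemma map_sub_right_eq {μ : Measure (Khat k)}
    (hinv : ∀ x : Khat k, Measure.map (fun y => x + y) μ = μ) (x : Khat k) :
    Measure.map (fun y => y - x) μ = μ := by
  simpa only [neg_add_eq_sub] using hinv (-x)

lemma measure_coset_eq {μ : Measure (Khat k)}
    (hinv : ∀ x : Khat k, Measure.map (fun y => x + y) μ = μ) (x : Khat k) (n : ℤ) :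
    μ (coset x n) = μ (coset 0 n) := by
  conv_rhs => rw [← map_sub_right_eq hinv x]
  rw [Measure.map_apply (measurable_sub_const x) (measurableSet_coset 0 n)]
  simp [coset]

lemma coset_zero_eq_iUnion (n : ℤ) :
    coset (0 : Khat k) n = ⋃ c : k, coset (HahnSeries.single n c) (n + 1) := by
  ext f
  simp only [Set.mem_iUnion, coset, Set.mem_ofPred, sub_zero, absInf_le_zpow_iff,
    HahnSeries.coeff_sub, sub_eq_zero, Int.lt_add_one_iff]
  constructor
  · intro h
    refine ⟨f.coeff n, fun i hi => ?_⟩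
    rcases hi.lt_or_eq with hi | rfl
    · rw [h i hi, HahnSeries.coeff_single_of_ne hi.ne]
    · rw [HahnSeries.coeff_single_same]
  · rintro ⟨c, hc⟩ i hi
    rw [hc i hi.le, HahnSeries.coeff_single_of_ne hi.ne]

lemma disjoint_coset_single (n : ℤ) :
    Pairwise (Function.onFun Disjoint
      fun c : k => coset (HahnSeries.single n c : Khat k) (n + 1)) := by
  intro c d hcd
  refine Set.disjoint_left.mpr fun f hc hd => hcd ?_
  simp only [coset, Set.mem_ofPred, absInf_le_zpow_iff, HahnSeries.coeff_sub, sub_eq_zero] at hc hd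
  simpa using (hc n (lt_add_one n)).symm.trans (hd n (lt_add_one n))

lemma measure_coset_zero_succ {μ : Measure (Khat k)}
    (hinv : ∀ x : Khat k, Measure.map (fun y => x + y) μ = μ) (n : ℤ) :
    μ (coset 0 n) = Fintype.card k * μ (coset 0 (n + 1)) := by
  rw [coset_zero_eq_iUnion, measure_iUnion (disjoint_coset_single n)
    fun c => measurableSet_coset _ _]
  simp [measure_coset_eq hinv (HahnSeries.single n _)]

lemma measure_coset {μ : Measure (Khat k)}
    (hinv : ∀ x : Khat k, Measure.map (fun y => x + y) μ = μ) (hO : μ (Oball k) = 1)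
    (x : Khat k) (n : ℤ) :
    μ (coset x n) = ENNReal.ofReal ((Fintype.card k : ℝ) ^ (-n)) := by
  have hq : (0 : ℝ) < Fintype.card k := zero_lt_one.trans (one_lt_card_real k)
  have step (n : ℤ) : ENNReal.ofReal ((Fintype.card k : ℝ) ^ (-n)) =
      Fintype.card k * ENNReal.ofReal ((Fintype.card k : ℝ) ^ (-(n + 1))) := by
    rw [← ENNReal.ofReal_natCast, ← ENNReal.ofReal_mul hq.le, neg_add, zpow_add₀ hq.ne',
      zpow_neg_one, mul_comm, inv_mul_cancel_right₀ hq.ne']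
  rw [measure_coset_eq hinv]
  induction n using Int.induction_on with
  | zero =>
    have : coset (0 : Khat k) 0 = Oball k := by simp [coset, Oball]
    simp [this, hO]
  | succ n ih =>
    rw [measure_coset_zero_succ hinv, step] at ih
    exact (ENNReal.mul_right_inj (by simp) (by simp)).mp ih
  | pred n ih =>
    rw [measure_coset_zero_succ hinv, step, sub_add_cancel, ih]

lemma sigmaFinite_of_invariant {μ : Measure (Khat k)}
    (hinv : ∀ x : Khat k, Measure.map (fun y => x + y) μ = μ) (hO : μ (Oball k) = 1) :
    SigmaFinite μ := by
  have : IsLocallyFiniteMeasure μ := ⟨fun x => ⟨coset x 0,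
    (isOpen_coset x 0).mem_nhds (mem_coset_self x 0), by simp [measure_coset hinv hO]⟩⟩
  infer_instance

lemma measure_singleton {μ : Measure (Khat k)}
    (hinv : ∀ x : Khat k, Measure.map (fun y => x + y) μ = μ) (hO : μ (Oball k) = 1)
    (x : Khat k) : μ {x} = 0 := by
  refine le_antisymm (le_of_forall_gt fun ε hε => ?_) zero_le
  obtain ⟨δ, hδ, hδε⟩ := ENNReal.lt_iff_exists_nnreal_btwn.mp hε
  obtain ⟨n, hn⟩ := exists_zpow_lt k (ε := δ) (by exact_mod_cast hδ)
  refine lt_of_le_of_lt (measure_mono (Set.singleton_subset_iff.mpr (mem_coset_self x n))) ?_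
  rw [measure_coset hinv hO]
  refine lt_of_le_of_lt ?_ hδε
  exact ENNReal.ofReal_le_of_le_toReal (by simpa using hn.le)

/-- The weight `|x|⁻²`. -/
def weight (x : Khat k) : ℝ≥0∞ := ENNReal.ofReal ((absInf x ^ 2)⁻¹)

lemma continuous_absInf : Continuous (absInf : Khat k → ℝ) := by
  have : (absInf : Khat k → ℝ) = fun x => dist x 0 := by
    funext x
    rw [dist_eq_absInf, sub_zero]
  rw [this]
  exact continuous_id.dist continuous_const

lemma measurable_weight : Measurable (weight : Khat k → ℝ≥0∞) :=
  (continuous_absInf.measurable.pow_const 2).inv.ennreal_ofReal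

lemma absInf_eq_of_mem_coset {x y : Khat k} {n : ℤ} (hx : (0 : Khat k) ∉ coset x n)
    (hy : y ∈ coset x n) : absInf y = absInf x := by
  rw [zero_notMem_coset_iff] at hx
  have := absInf_add_eq_left (f := x) (g := y - x) (lt_of_le_of_lt hy hx)
  rwa [add_sub_cancel] at this

lemma zero_notMem_coset_inv {x : Khat k} {n m : ℤ} (hx : (0 : Khat k) ∉ coset x n)
    (hm : absInf x = (Fintype.card k : ℝ) ^ (-m)) : (0 : Khat k) ∉ coset x⁻¹ (n - 2 * m) := by
  rw [zero_notMem_coset_iff] at hx ⊢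
  rw [hm, zpow_lt_zpow_iff_right₀ (one_lt_card_real k)] at hx
  rw [absInf_inv, hm, ← zpow_neg, zpow_lt_zpow_iff_right₀ (one_lt_card_real k)]
  lia

lemma ne_zero_of_zero_notMem_coset {x : Khat k} {n : ℤ} (hx : (0 : Khat k) ∉ coset x n) :
    x ≠ 0 :=
  fun h => hx (h ▸ mem_coset_self x n)

lemma inv_mem_coset_inv {x y : Khat k} {n m : ℤ} (hx : (0 : Khat k) ∉ coset x n)
    (hm : absInf x = (Fintype.card k : ℝ) ^ (-m)) (hy : y ∈ coset x n) :
    y⁻¹ ∈ coset x⁻¹ (n - 2 * m) := by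
  have hq : (0 : ℝ) < Fintype.card k := zero_lt_one.trans (one_lt_card_real k)
  have hx0 : x ≠ 0 := ne_zero_of_zero_notMem_coset hx
  have hy0 : y ≠ 0 := fun h => hx (h ▸ hy)
  have hxy := absInf_eq_of_mem_coset hx hy
  have h : y⁻¹ - x⁻¹ = -(y - x) * (y⁻¹ * x⁻¹) := by
    field_simp
    ring
  simp only [coset, Set.mem_ofPred] at hy ⊢
  rw [h, absInf_mul, absInf_neg, absInf_mul, absInf_inv, absInf_inv, hxy, hm, ← zpow_neg,
    show -(n - 2 * m) = -n + (- -m + - -m) by ring]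
  rw [← zpow_add₀ hq.ne', zpow_add₀ hq.ne' (-n)]
  exact mul_le_mul_of_nonneg_right hy (card_zpow_pos k _).le

lemma preimage_inv_coset {x : Khat k} {n m : ℤ} (hx : (0 : Khat k) ∉ coset x n)
    (hm : absInf x = (Fintype.card k : ℝ) ^ (-m)) :
    (fun y : Khat k => y⁻¹) ⁻¹' coset x n = coset x⁻¹ (n - 2 * m) := by
  ext y
  constructor
  · intro hy
    simpa using inv_mem_coset_inv hx hm hy
  · intro hy
    have hm' : absInf x⁻¹ = (Fintype.card k : ℝ) ^ (-(-m)) := by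
      rw [absInf_inv, hm, ← zpow_neg]
    have := inv_mem_coset_inv (zero_notMem_coset_inv hx hm) hm' hy
    rwa [inv_inv, show n - 2 * m - 2 * -m = n by ring] at this

lemma measurable_inv_khat : Measurable fun x : Khat k => x⁻¹ := by
  refine measurable_of_continuousOn_compl_singleton 0 fun x hx =>
    ContinuousAt.continuousWithinAt ?_
  have hx0 : x⁻¹ ≠ 0 := inv_ne_zero hx
  obtain ⟨m, hm⟩ := exists_absInf_eq_zpow hx0
  refine Metric.continuousAt_iff'.mpr fun ε hε => ?_
  obtain ⟨n, hn⟩ := exists_zpow_lt k (lt_min hε (absInf_pos hx0))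
  rw [lt_min_iff] at hn
  have hpre := preimage_inv_coset ((zero_notMem_coset_iff x⁻¹ n).mpr hn.2) hm
  rw [inv_inv] at hpre
  have hmem : (fun y : Khat k => y⁻¹) ⁻¹' coset x⁻¹ n ∈ nhds x := by
    rw [hpre]
    exact (isOpen_coset _ _).mem_nhds (mem_coset_self x _)
  filter_upwards [hmem] with y hy
  exact lt_of_le_of_lt hy hn.1

lemma measurePreserving_inv {μ : Measure (Khat k)}
    (hinv : ∀ x : Khat k, Measure.map (fun y => x + y) μ = μ) (hO : μ (Oball k) = 1) :
    MeasurePreserving (fun x : Khat k => x⁻¹) (μ.withDensity weight) μ := by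
  refine ⟨measurable_inv_khat, ?_⟩
  have key (x : Khat k) (n : ℤ) (hx : (0 : Khat k) ∉ coset x n) :
      Measure.map (fun x : Khat k => x⁻¹) (μ.withDensity weight) (coset x n) =
        μ (coset x n) := by
    have hq : (0 : ℝ) < Fintype.card k := zero_lt_one.trans (one_lt_card_real k)
    obtain ⟨m, hm⟩ := exists_absInf_eq_zpow (ne_zero_of_zero_notMem_coset hx)
    rw [Measure.map_apply measurable_inv_khat (measurableSet_coset x n),
      preimage_inv_coset hx hm, withDensity_apply _ (measurableSet_coset _ _),
      setLIntegral_congr_fun (g := fun _ => weight x⁻¹) (measurableSet_coset _ _) fun y hy => by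
        simp only [weight, absInf_eq_of_mem_coset (zero_notMem_coset_inv hx hm) hy],
      setLIntegral_const, measure_coset hinv hO, measure_coset hinv hO, weight,
      ← ENNReal.ofReal_mul (by positivity), absInf_inv, hm, inv_pow, inv_inv, ← zpow_natCast,
      ← zpow_mul, ← zpow_add₀ hq.ne']
    congr 2
    push_cast
    ring
  refine ext_of_coset ?_ (fun x n hx => ?_) key
  · have : (fun x : Khat k => x⁻¹) ⁻¹' {0} = {0} := by
      ext x
      simp
    rw [Measure.map_apply measurable_inv_khat (measurableSet_singleton 0), this,
      measure_singleton hinv hO]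
    exact withDensity_absolutelyContinuous μ weight (measure_singleton hinv hO 0)
  · rw [key x n hx, measure_coset hinv hO]
    exact ENNReal.ofReal_ne_top

lemma measurePreserving_inv_symm {μ : Measure (Khat k)}
    (hinv : ∀ x : Khat k, Measure.map (fun y => x + y) μ = μ) (hO : μ (Oball k) = 1) :
    MeasurePreserving (fun x : Khat k => x⁻¹) μ (μ.withDensity weight) := by
  refine ⟨measurable_inv_khat, ?_⟩
  conv_lhs => rw [← (measurePreserving_inv hinv hO).map_eq]
  rw [Measure.map_map measurable_inv_khat measurable_inv_khat]
  simp

lemma intPart_congr {f g : Khat k} (h : absInf (f - g) < 1) : intPart f = intPart g := by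
  rw [absInf_lt_one_iff] at h
  ext i
  simp only [coeff_intPart]
  split_ifs with hi
  · simpa [sub_eq_zero] using h i hi
  · rfl

lemma absInf_fracPart_lt_one (f : Khat k) : absInf (fracPart f) < 1 := by
  rw [absInf_lt_one_iff]
  intro i hi
  simp [fracPart, coeff_intPart, hi]

lemma intPart_eq_zero_iff (f : Khat k) : intPart f = 0 ↔ absInf f < 1 := by
  constructor
  · intro h
    simpa [fracPart, h] using absInf_fracPart_lt_one f
  · intro h
    rw [← sub_zero f] at h
    rw [intPart_congr h]
    ext i
    simp [coeff_intPart]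

lemma measurable_intPart : Measurable (intPart : Khat k → Khat k) := by
  refine Continuous.measurable (Metric.continuous_iff.mpr fun f ε hε => ⟨1, one_pos, ?_⟩)
  intro g h
  rw [dist_eq_absInf] at h
  rwa [intPart_congr h, dist_self]

lemma measurable_fracPart : Measurable (fracPart : Khat k → Khat k) :=
  measurable_id.sub measurable_intPart

lemma measurable_PhiRaw : Measurable (PhiRaw : Khat k × Khat k → Khat k × Khat k) :=
  Measurable.prodMk
    ((measurable_inv_khat.comp measurable_fst).sub
      (measurable_intPart.comp (measurable_inv_khat.comp measurable_snd)))
    (measurable_fracPart.comp (measurable_inv_khat.comp measurable_snd))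

lemma absInf_Xinv : absInf (Xinv k) = (Fintype.card k : ℝ)⁻¹ := by
  simp [absInf, Xinv]

lemma XinvO_eq : XinvO k = {x | absInf x < 1} := by
  have hX : Xinv k ≠ 0 := by simp [Xinv]
  have hq := one_lt_card_real k
  have h (f : Khat k) : absInf f < 1 ↔ absInf f ≤ (Fintype.card k : ℝ) ^ (-(1 : ℤ)) := by
    rw [absInf_le_zpow_iff, absInf_lt_one_iff]
    simp [Int.lt_iff_add_one_le]
  ext f
  simp only [XinvO, Oball, Set.mem_image, Set.mem_ofPred]
  constructor
  · rintro ⟨g, hg, rfl⟩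
    rw [absInf_mul, absInf_Xinv]
    exact mul_lt_one_of_nonneg_of_lt_one_left (by positivity) (inv_lt_one_of_one_lt₀ hq) hg
  · intro hf
    refine ⟨(Xinv k)⁻¹ * f, ?_, mul_inv_cancel_left₀ hX f⟩
    rw [absInf_mul, absInf_inv, absInf_Xinv, inv_inv, ← le_inv_mul_iff₀ (by positivity)]
    simpa using (h f).mp hf

lemma one_lt_absInf_of_mem_AmK {a : Khat k} (ha : a ∈ AmK k) : 1 < absInf a := by
  by_contra! h
  refine ha.2 ⟨a.coeff 0, ?_⟩
  have h' := (absInf_le_zpow_iff a 0).mp (by simpa using h)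
  ext i
  rw [coeff_algebraMap_khat, ← intPart_eq_self_of_mem_Aset ha.1, coeff_intPart, coeff_intPart]
  rcases lt_trichotomy i 0 with hi | rfl | hi
  · simp [hi.ne, h' i hi]
  · simp
  · simp [hi.ne', hi.not_ge]

lemma absInf_intPart {f : Khat k} (hf : 1 < absInf f) : absInf (intPart f) = absInf f := by
  have h := absInf_add_eq_left (f := f) (g := -fracPart f)
    (by rw [absInf_neg]; exact (absInf_fracPart_lt_one f).trans hf)
  rwa [fracPart, neg_sub, add_sub_cancel] at h

lemma Jset_eq : Jset k = {x | 1 < absInf x} := by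
  ext f
  simp only [Jset, XinvO_eq, Set.mem_iUnion, Set.mem_image, Set.mem_ofPred]
  constructor
  · rintro ⟨a, ha, x, hx, rfl⟩
    have := one_lt_absInf_of_mem_AmK ha
    rwa [absInf_add_eq_left (hx.trans this)]
  · intro hf
    refine ⟨intPart f, ⟨intPart_mem_Aset f, ?_⟩, fracPart f, absInf_fracPart_lt_one f,
      add_sub_cancel _ _⟩
    rintro ⟨c, hc⟩
    rw [← absInf_intPart hf, ← hc] at hf
    refine hf.not_ge ?_
    have := (absInf_le_zpow_iff (algebraMap k (Khat k) c) 0).mpr fun i hi => by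
      rw [coeff_algebraMap_khat, if_neg hi.ne]
    simpa using this

lemma countable_Kset : (Kset k).Countable := by
  have : Countable (Polynomial k) := Cardinal.mk_le_aleph0_iff.mp
    (Polynomial.cardinalMk_le_max.trans (by simp))
  refine (Set.countable_range fun p : Polynomial k × Polynomial k =>
    ((algebraMap _ (RatFunc k) p.1 / algebraMap _ (RatFunc k) p.2 : RatFunc k) :
      LaurentSeries k)).mono ?_
  rintro _ ⟨r, rfl⟩
  induction r using RatFunc.induction_on with
  | f p q hq => exact ⟨(p, q), rfl⟩

lemma measurableSet_absInf_lt_one : MeasurableSet {x : Khat k | absInf x < 1} :=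
  measurableSet_lt continuous_absInf.measurable measurable_const

lemma measurableSet_one_lt_absInf : MeasurableSet {x : Khat k | 1 < absInf x} :=
  measurableSet_lt measurable_const continuous_absInf.measurable

lemma OmegaSet_ae_eq {μ : Measure (Khat k)}
    (hinv : ∀ x : Khat k, Measure.map (fun y => x + y) μ = μ) (hO : μ (Oball k) = 1) :
    OmegaSet k =ᵐ[μ.prod μ] {x | 1 < absInf x} ×ˢ {x | absInf x < 1} := by
  have : SigmaFinite μ := sigmaFinite_of_invariant hinv hO
  have hK : ∀ᵐ x ∂μ, x ∈ cK k := by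
    refine measure_eq_zero_iff_ae_notMem.mp ?_
    rw [← Set.biUnion_of_singleton (Kset k)]
    exact (measure_biUnion_null_iff countable_Kset).mpr fun x _ => measure_singleton hinv hO x
  filter_upwards [Measure.quasiMeasurePreserving_fst.ae hK,
    Measure.quasiMeasurePreserving_snd.ae hK] with p h1 h2
  refine propext ?_
  change p ∈ OmegaSet k ↔ p ∈ {x | 1 < absInf x} ×ˢ {x | absInf x < 1}
  simp [OmegaSet, Jset_eq, XinvO_eq, h1, h2, Set.mem_prod]

lemma mhat_eq {μ : Measure (Khat k)}
    (hinv : ∀ x : Khat k, Measure.map (fun y => x + y) μ = μ) (hO : μ (Oball k) = 1) :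
    mhat k μ = ENNReal.ofReal ((Fintype.card k : ℝ) ^ 2) •
      ((μ.prod μ).withDensity fun p => weight p.1).restrict
        ({x | 1 < absInf x} ×ˢ {x | absInf x < 1}) := by
  have hms : MeasurableSet ({x : Khat k | 1 < absInf x} ×ˢ {x : Khat k | absInf x < 1}) :=
    measurableSet_one_lt_absInf.prod measurableSet_absInf_lt_one
  rw [mhat, Measure.restrict_congr_set
    ((withDensity_absolutelyContinuous _ _).ae_eq (OmegaSet_ae_eq hinv hO)),
    restrict_withDensity hms, restrict_withDensity hms,
    ← withDensity_smul _ (f := fun p : Khat k × Khat k => weight p.1)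
      (measurable_weight.comp measurable_fst)]
  refine withDensity_congr_ae ?_
  filter_upwards [ae_restrict_mem hms] with p hp
  have h : absInf (p.2 - p.1) = absInf p.1 := by
    rw [absInf_sub_comm, sub_eq_add_neg,
      absInf_add_eq_left (by rw [absInf_neg]; exact lt_trans hp.2 hp.1)]
  rw [dens, h, ENNReal.ofReal_mul (by positivity)]
  rfl

lemma withDensity_comp_measurePreserving {α β : Type*} [MeasurableSpace α] [MeasurableSpace β]
    {μ : Measure α} {ν : Measure β} {f : α → β} (hf : MeasurePreserving f μ ν) {g : β → ℝ≥0∞}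
    (hg : Measurable g) :
    MeasurePreserving f (μ.withDensity (g ∘ f)) (ν.withDensity g) := by
  refine ⟨hf.measurable, Measure.ext fun s hs => ?_⟩
  rw [Measure.map_apply hf.measurable hs, withDensity_apply _ (hf.measurable hs),
    withDensity_apply _ hs, ← hf.setLIntegral_comp_preimage hs hg]
  rfl

lemma measurePreserving_doubleShear {μ : Measure (Khat k)} [SigmaFinite μ]
    (hinv : ∀ x : Khat k, Measure.map (fun y => x + y) μ = μ) :
    MeasurePreserving doubleShear (μ.prod μ) (μ.prod μ) := by
  have h1 : MeasurePreserving (fun p : Khat k × Khat k => (p.1, p.2 - intPart p.1))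
      (μ.prod μ) (μ.prod μ) :=
    (MeasurePreserving.id μ).skew_product (g := fun x y => y - intPart x)
      (measurable_snd.sub (measurable_intPart.comp measurable_fst))
      (.of_forall fun x => map_sub_right_eq hinv _)
  have h2 : MeasurePreserving (fun p : Khat k × Khat k => (p.1, intPart p.1 + p.2))
      (μ.prod μ) (μ.prod μ) :=
    (MeasurePreserving.id μ).skew_product (g := fun x y => intPart x + y)
      ((measurable_intPart.comp measurable_fst).add measurable_snd)
      (.of_forall fun x => hinv _)
  have h3 : MeasurePreserving Prod.swap (μ.prod μ) (μ.prod μ) := Measure.measurePreserving_swap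
  convert h2.comp (h3.comp (h1.comp h3)) using 1
  funext p
  simp [doubleShear, add_comm]

lemma absInf_sub_intPart {u v : Khat k} (hu : absInf u < 1) (hv : 1 < absInf v) :
    absInf (u - intPart v) = absInf v := by
  have h := absInf_intPart hv
  rw [absInf_sub_comm, sub_eq_add_neg, absInf_add_eq_left, h]
  rw [absInf_neg, h]
  exact hu.trans hv

lemma preimage_doubleShear :
    (doubleShear (k := k)) ⁻¹' ({x | 1 < absInf x} ×ˢ {x | absInf x < 1}) =
      {x | absInf x < 1} ×ˢ {x | 1 < absInf x} := by
  ext p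
  simp only [Set.mem_preimage, Set.mem_prod, Set.mem_ofPred]
  rw [← intPart_eq_zero_iff, intPart_doubleShear_snd, intPart_eq_zero_iff, and_comm]
  refine and_congr_right fun hu => ⟨fun h => ?_, fun hv => ?_⟩
  · have h' := absInf_intPart h
    simp only [doubleShear, sub_eq_add_neg, intPart_add, intPart_neg, intPart_intPart,
      (intPart_eq_zero_iff p.1).mpr hu, zero_add, absInf_neg] at h h'
    have hlt : 1 < absInf (intPart p.2) := by rwa [h']
    have := absInf_add_eq_left (f := intPart p.2) (g := fracPart p.2)
      ((absInf_fracPart_lt_one _).trans hlt)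
    rw [fracPart, add_sub_cancel] at this
    rwa [this]
  · simpa only [doubleShear, absInf_sub_intPart hu hv] using hv

lemma measurePreserving_doubleShear_weight {μ : Measure (Khat k)} [SigmaFinite μ]
    (hinv : ∀ x : Khat k, Measure.map (fun y => x + y) μ = μ) :
    MeasurePreserving doubleShear
      (((μ.prod μ).withDensity fun p => weight p.2).restrict
        ({x | absInf x < 1} ×ˢ {x | 1 < absInf x}))
      (((μ.prod μ).withDensity fun p => weight p.1).restrict
        ({x | 1 < absInf x} ×ˢ {x | absInf x < 1})) := by
  have hms : MeasurableSet ({x : Khat k | absInf x < 1} ×ˢ {x : Khat k | 1 < absInf x}) :=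
    measurableSet_absInf_lt_one.prod measurableSet_one_lt_absInf
  have h := (withDensity_comp_measurePreserving (measurePreserving_doubleShear hinv)
    (g := fun p => weight p.1) (measurable_weight.comp measurable_fst)).restrict_preimage
    (measurableSet_one_lt_absInf.prod measurableSet_absInf_lt_one)
  rw [preimage_doubleShear, restrict_withDensity hms] at h
  rw [restrict_withDensity hms]
  convert h using 1
  refine withDensity_congr_ae ?_
  filter_upwards [ae_restrict_mem hms] with p hp
  simp only [Function.comp_apply, weight, doubleShear, absInf_sub_intPart hp.1 hp.2]

lemma measurePreserving_inv_prod {μ : Measure (Khat k)} [SigmaFinite μ]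
    (hinv : ∀ x : Khat k, Measure.map (fun y => x + y) μ = μ) (hO : μ (Oball k) = 1) :
    MeasurePreserving (Prod.map (fun x : Khat k => x⁻¹) (fun x : Khat k => x⁻¹))
      (((μ.prod μ).withDensity fun p => weight p.1).restrict
        ({x | 1 < absInf x} ×ˢ {x | absInf x < 1}))
      (((μ.prod μ).withDensity fun p => weight p.2).restrict
        ({x | absInf x < 1} ×ˢ {x | 1 < absInf x})) := by
  have : SFinite (μ.withDensity weight) := inferInstance
  have h0 : ∀ᵐ x ∂μ, x ≠ 0 := by
    simpa [ae_iff] using measure_singleton hinv hO 0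
  have h1 := (measurePreserving_inv hinv hO).restrict_preimage measurableSet_absInf_lt_one
  have h2 := (measurePreserving_inv_symm hinv hO).restrict_preimage measurableSet_one_lt_absInf
  have e1 : (fun x : Khat k => x⁻¹) ⁻¹' {x | absInf x < 1} =ᵐ[μ.withDensity weight]
      {x | 1 < absInf x} := by
    refine (withDensity_absolutelyContinuous _ _).ae_eq ?_
    filter_upwards [h0] with x hx
    refine propext ?_
    change absInf x⁻¹ < 1 ↔ 1 < absInf x
    rw [absInf_inv, inv_lt_one₀ (absInf_pos hx)]
  have e2 : (fun x : Khat k => x⁻¹) ⁻¹' {x | 1 < absInf x} =ᵐ[μ] {x | absInf x < 1} := by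
    filter_upwards [h0] with x hx
    refine propext ?_
    change 1 < absInf x⁻¹ ↔ absInf x < 1
    rw [absInf_inv, one_lt_inv₀ (absInf_pos hx)]
  rw [Measure.restrict_congr_set e1] at h1
  rw [Measure.restrict_congr_set e2] at h2
  have h := h1.prod h2
  rwa [Measure.prod_restrict, Measure.prod_restrict, prod_withDensity_left measurable_weight,
    prod_withDensity_right measurable_weight] at h

end

/-- The natural extension `Φ(ξ₋,ξ₊) = (1/ξ₋ - [1/ξ₊], Ψ(ξ₊))` of the Artin
map preserves the probability measure `m̂`. -/
theorem statement_9 (k : Type*) [Field k] [Fintype k] (μ : MeasureTheory.Measure (Khat k))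
    (hinv : ∀ x : Khat k, MeasureTheory.Measure.map (fun y => x + y) μ = μ)
    (hO : μ (Oball k) = 1) :
    MeasureTheory.MeasurePreserving (PhiRaw (k := k)) (mhat k μ) (mhat k μ) := by
  have : SigmaFinite μ := sigmaFinite_of_invariant hinv hO
  have hms : MeasurableSet ({x : Khat k | 1 < absInf x} ×ˢ {x : Khat k | absInf x < 1}) :=
    measurableSet_one_lt_absInf.prod measurableSet_absInf_lt_one
  rw [mhat_eq hinv hO]
  refine MeasurePreserving.smul_measure ?_ _
  have h := (measurePreserving_doubleShear_weight hinv).comp (measurePreserving_inv_prod hinv hO)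
  refine ⟨measurable_PhiRaw, Eq.trans (Measure.map_congr ?_) h.map_eq⟩
  filter_upwards [ae_restrict_mem hms] with p hp
  have hu : intPart p.1⁻¹ = 0 := by
    rw [intPart_eq_zero_iff, absInf_inv]
    exact inv_lt_one_of_one_lt₀ hp.1
  simp [PhiRaw, ArtinPsi, fracPart, doubleShear, sub_eq_add_neg, intPart_add, intPart_neg,
    intPart_intPart, hu]

end ArtinCoding
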